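/- Let π_n and η be any two policies such that E_{s∼d_{π_n}}[D_TV(η(·|s), π_n(·|s))] ≤ α for some α ≥ 0. Then the joint state-action distributions satisfy ‖d_η η − d_{π_n} π_n‖₁ ≤ 4α/(1−γ). -/

import Mathlib

open scoped BigOperators

noncomputable section

/-- `p` is a probability distribution on a finite type. -/
def IsDist {X : Type*} [Fintype X] (p : X → ℝ) : Prop :=
  (∀ x, 0 ≤ p x) ∧ ∑ x, p x = 1

/-- `P` is a transition dynamics: `P s a` is a distribution over next states. -/
def IsDynamics {S A : Type*} [Fintype S] (P : S → A → S → ℝ) : Prop :=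
  ∀ s a, IsDist (P s a)

/-- `π` is a (stochastic) policy: `π s` is a distribution over actions. -/
def IsPolicy {S A : Type*} [Fintype A] (π : S → A → ℝ) : Prop :=
  ∀ s, IsDist (π s)

/-- One-step evolution of a state distribution under policy `π` and dynamics `P`. -/
def step {S A : Type*} [Fintype S] [Fintype A]
    (P : S → A → S → ℝ) (π : S → A → ℝ) (d : S → ℝ) : S → ℝ :=
  fun s' => ∑ s, ∑ a, d s * π s a * P s a s'

/-- The time-`t` state distribution `d_π^t` starting from `ρ₀`. -/
def stateDist {S A : Type*} [Fintype S] [Fintype A]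
    (P : S → A → S → ℝ) (π : S → A → ℝ) (ρ₀ : S → ℝ) : ℕ → S → ℝ
  | 0 => ρ₀
  | t + 1 => step P π (stateDist P π ρ₀ t)

/-- Discounted state visitation distribution `d_π = (1-γ) Σ_t γ^t d_π^t`. -/
def visit {S A : Type*} [Fintype S] [Fintype A]
    (γ : ℝ) (P : S → A → S → ℝ) (π : S → A → ℝ) (ρ₀ : S → ℝ) : S → ℝ :=
  fun s => (1 - γ) * ∑' t : ℕ, γ ^ t * stateDist P π ρ₀ t s

/-- Expected cost of one step when the state is distributed as `d` and actions follow `π`. -/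
def expCost {S A : Type*} [Fintype S] [Fintype A]
    (c : S → A → ℝ) (π : S → A → ℝ) (d : S → ℝ) : ℝ :=
  ∑ s, ∑ a, d s * π s a * c s a

/-- Value function `V^π(s₀)`: expected total discounted cost starting at `s₀`. -/
def Vf {S A : Type*} [Fintype S] [Fintype A] [DecidableEq S]
    (γ : ℝ) (P : S → A → S → ℝ) (c : S → A → ℝ) (π : S → A → ℝ) (s₀ : S) : ℝ :=
  ∑' t : ℕ, γ ^ t * expCost c π (stateDist P π (fun s => if s = s₀ then 1 else 0) t)

/-- Objective `J(π) = E_{s∼ρ₀}[V^π(s)]`. -/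
def Jf {S A : Type*} [Fintype S] [Fintype A] [DecidableEq S]
    (γ : ℝ) (P : S → A → S → ℝ) (c : S → A → ℝ) (ρ₀ : S → ℝ) (π : S → A → ℝ) : ℝ :=
  ∑ s, ρ₀ s * Vf γ P c π s

/-- State-action value `Q^π(s,a) = c(s,a) + γ E_{s'∼P_{s,a}}[V^π(s')]`. -/
def Qf {S A : Type*} [Fintype S] [Fintype A] [DecidableEq S]
    (γ : ℝ) (P : S → A → S → ℝ) (c : S → A → ℝ) (π : S → A → ℝ) (s : S) (a : A) : ℝ :=
  c s a + γ * ∑ s', P s a s' * Vf γ P c π s'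

/-- Disadvantage function `A^π(s,a) = Q^π(s,a) - V^π(s)`. -/
def Adv {S A : Type*} [Fintype S] [Fintype A] [DecidableEq S]
    (γ : ℝ) (P : S → A → S → ℝ) (c : S → A → ℝ) (π : S → A → ℝ) (s : S) (a : A) : ℝ :=
  Qf γ P c π s a - Vf γ P c π s

theorem IsDist.step {S A : Type*} [Fintype S] [Fintype A] {P : S → A → S → ℝ} {π : S → A → ℝ}
    {d : S → ℝ} (hd : IsDist d) (hP : IsDynamics P) (hπ : IsPolicy π) : IsDist (step P π d) := by
  refine ⟨fun s' => Finset.sum_nonneg fun s _ => Finset.sum_nonneg fun a _ =>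
    mul_nonneg (mul_nonneg (hd.1 s) ((hπ s).1 a)) ((hP s a).1 s'), ?_⟩
  unfold _root_.step
  rw [Finset.sum_comm, ← hd.2]
  refine Finset.sum_congr rfl fun s _ => ?_
  rw [Finset.sum_comm]
  simp_rw [← Finset.mul_sum, (hP s _).2, mul_one, ← Finset.mul_sum, (hπ s).2, mul_one]

theorem isDist_stateDist {S A : Type*} [Fintype S] [Fintype A] {P : S → A → S → ℝ}
    {π : S → A → ℝ} {ρ₀ : S → ℝ} (hP : IsDynamics P) (hπ : IsPolicy π) (hρ : IsDist ρ₀) (t : ℕ) :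
    IsDist (stateDist P π ρ₀ t) := by
  induction t with
  | zero => exact hρ
  | succ t ih => exact ih.step hP hπ

theorem IsDist.le_one {X : Type*} [Fintype X] {p : X → ℝ} (hp : IsDist p) (x : X) : p x ≤ 1 := by
  rw [← hp.2]
  exact Finset.single_le_sum (fun y _ => hp.1 y) (Finset.mem_univ x)

theorem summable_discounted_stateDist {S A : Type*} [Fintype S] [Fintype A] {γ : ℝ}
    {P : S → A → S → ℝ} {π : S → A → ℝ} {ρ₀ : S → ℝ} (hγ : 0 ≤ γ) (hγ' : γ < 1)
    (hP : IsDynamics P) (hπ : IsPolicy π) (hρ : IsDist ρ₀) (s : S) :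
    Summable fun t : ℕ => γ ^ t * stateDist P π ρ₀ t s := by
  refine (summable_geometric_of_lt_one hγ hγ').of_nonneg_of_le (fun t => ?_) fun t => ?_
  · exact mul_nonneg (pow_nonneg hγ t) ((isDist_stateDist hP hπ hρ t).1 s)
  · exact mul_le_of_le_one_right (pow_nonneg hγ t) ((isDist_stateDist hP hπ hρ t).le_one s)

theorem visit_nonneg {S A : Type*} [Fintype S] [Fintype A] {γ : ℝ}
    {P : S → A → S → ℝ} {π : S → A → ℝ} {ρ₀ : S → ℝ} (hγ : 0 ≤ γ) (hγ' : γ < 1)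
    (hP : IsDynamics P) (hπ : IsPolicy π) (hρ : IsDist ρ₀) (s : S) :
    0 ≤ visit γ P π ρ₀ s :=
  mul_nonneg (sub_nonneg.2 hγ'.le) <| tsum_nonneg fun t =>
    mul_nonneg (pow_nonneg hγ t) ((isDist_stateDist hP hπ hρ t).1 s)

/-- The discounted visitation distribution satisfies the Bellman flow equation. -/
theorem visit_eq_add_step {S A : Type*} [Fintype S] [Fintype A] {γ : ℝ}
    {P : S → A → S → ℝ} {π : S → A → ℝ} {ρ₀ : S → ℝ} (hγ : 0 ≤ γ) (hγ' : γ < 1)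
    (hP : IsDynamics P) (hπ : IsPolicy π) (hρ : IsDist ρ₀) (s' : S) :
    visit γ P π ρ₀ s' = (1 - γ) * ρ₀ s' + γ * step P π (visit γ P π ρ₀) s' := by
  have hs := summable_discounted_stateDist hγ hγ' hP hπ hρ
  have hstep : HasSum (fun t : ℕ => γ ^ t * stateDist P π ρ₀ (t + 1) s')
      (step P π (fun s => ∑' t : ℕ, γ ^ t * stateDist P π ρ₀ t s) s') := by
    have h := hasSum_sum (s := Finset.univ) fun (s : S) _ =>
      hasSum_sum (s := Finset.univ) fun (a : A) _ =>
        ((hs s).hasSum.mul_right (π s a)).mul_right (P s a s')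
    refine h.congr_fun fun t => ?_
    simp only [stateDist, step, Finset.mul_sum, mul_assoc]
  have hlin : step P π (visit γ P π ρ₀) s' =
      (1 - γ) * step P π (fun s => ∑' t : ℕ, γ ^ t * stateDist P π ρ₀ t s) s' := by
    simp only [step, visit, Finset.mul_sum, mul_assoc]
  rw [hlin, ← hstep.tsum_eq, visit, (hs s').tsum_eq_zero_add]
  simp only [pow_succ', mul_assoc, tsum_mul_left, pow_zero, one_mul, stateDist]
  ring

/-- One step of the dynamics contracts the `L¹` distance between joint state-action measures. -/
theorem sum_abs_step_sub_step_le {S A : Type*} [Fintype S] [Fintype A] {P : S → A → S → ℝ}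
    (hP : IsDynamics P) (π π' : S → A → ℝ) (d d' : S → ℝ) :
    ∑ s', |step P π d s' - step P π' d' s'| ≤ ∑ s, ∑ a, |d s * π s a - d' s * π' s a| := by
  calc ∑ s', |step P π d s' - step P π' d' s'|
      ≤ ∑ s', ∑ s, ∑ a, |d s * π s a - d' s * π' s a| * P s a s' := by
        refine Finset.sum_le_sum fun s' _ => ?_
        simp only [step, ← Finset.sum_sub_distrib, ← sub_mul]
        refine (Finset.abs_sum_le_sum_abs _ _).trans (Finset.sum_le_sum fun s _ => ?_)
        refine (Finset.abs_sum_le_sum_abs _ _).trans (Finset.sum_le_sum fun a _ => ?_)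
        rw [abs_mul, abs_of_nonneg ((hP s a).1 s')]
    _ = ∑ s, ∑ a, |d s * π s a - d' s * π' s a| := by
        rw [Finset.sum_comm]
        refine Finset.sum_congr rfl fun s _ => ?_
        rw [Finset.sum_comm]
        simp_rw [← Finset.mul_sum, (hP s _).2, mul_one]

/-- The `L¹` distance of joint measures is at most that of the marginals plus the expected
`L¹` distance of the policies. -/
theorem sum_abs_joint_sub_le {S A : Type*} [Fintype S] [Fintype A] {π π' : S → A → ℝ}
    {d d' : S → ℝ} (hπ : IsPolicy π) (hd' : ∀ s, 0 ≤ d' s) :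
    ∑ s, ∑ a, |d s * π s a - d' s * π' s a| ≤
      ∑ s, |d s - d' s| + ∑ s, d' s * ∑ a, |π s a - π' s a| := by
  rw [← Finset.sum_add_distrib]
  refine Finset.sum_le_sum fun s _ => ?_
  calc ∑ a, |d s * π s a - d' s * π' s a|
      ≤ ∑ a, (|d s - d' s| * π s a + d' s * |π s a - π' s a|) := by
        refine Finset.sum_le_sum fun a _ => ?_
        rw [show d s * π s a - d' s * π' s a =
          (d s - d' s) * π s a + d' s * (π s a - π' s a) by ring]
        refine (abs_add_le _ _).trans_eq ?_
        rw [abs_mul, abs_mul, abs_of_nonneg ((hπ s).1 a), abs_of_nonneg (hd' s)]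
    _ = |d s - d' s| + d' s * ∑ a, |π s a - π' s a| := by
        rw [Finset.sum_add_distrib, ← Finset.mul_sum, ← Finset.mul_sum, (hπ s).2, mul_one]

/-- If `E_{s∼d_{π_n}}[D_TV(η(·|s), π_n(·|s))] ≤ α`, then the joint state-action distributions
satisfy `‖d_η η - d_{π_n} π_n‖₁ ≤ 4α/(1-γ)`. -/
theorem joint_visit_l1_diff_le
    {S A : Type*} [Fintype S] [Fintype A]
    (γ : ℝ) (P : S → A → S → ℝ) (ρ₀ : S → ℝ)
    (hγ : 0 < γ) (hγ' : γ < 1) (hP : IsDynamics P) (hρ : IsDist ρ₀)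
    (πn η : S → A → ℝ) (hπn : IsPolicy πn) (hη : IsPolicy η)
    (α : ℝ) (hα : 0 ≤ α)
    (htv : ∑ s, visit γ P πn ρ₀ s * ((∑ a, |η s a - πn s a|) / 2) ≤ α) :
    ∑ s, ∑ a, |visit γ P η ρ₀ s * η s a - visit γ P πn ρ₀ s * πn s a| ≤
      4 * α / (1 - γ) := by
  have hjoint := sum_abs_joint_sub_le (d := visit γ P η ρ₀) (π' := πn) hη
    (visit_nonneg hγ.le hγ' hP hπn hρ)
  have hmarginal : ∑ s, |visit γ P η ρ₀ s - visit γ P πn ρ₀ s| ≤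
      γ * ∑ s, ∑ a, |visit γ P η ρ₀ s * η s a - visit γ P πn ρ₀ s * πn s a| := by
    refine le_trans (le_of_eq ?_) (mul_le_mul_of_nonneg_left
      (sum_abs_step_sub_step_le hP η πn (visit γ P η ρ₀) (visit γ P πn ρ₀)) hγ.le)
    rw [Finset.mul_sum]
    refine Finset.sum_congr rfl fun s _ => ?_
    rw [visit_eq_add_step hγ.le hγ' hP hη hρ s, visit_eq_add_step hγ.le hγ' hP hπn hρ s,
      add_sub_add_left_eq_sub, ← mul_sub, abs_mul, abs_of_pos hγ]
  simp only [← mul_div_assoc, ← Finset.sum_div] at htv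
  rw [le_div_iff₀ (sub_pos.2 hγ')]
  linarith
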